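/- Let k be a perfect field and let C be a k-linear additive category which is Krull–Schmidt (every object decomposes into a finite direct sum of indecomposable objects with local endomorphism rings) and in which the endomorphism algebra End_C(x) of every object x is finite-dimensional over k. Then the Chern character h : K₀(C) ⊗_ℤ k → HH₀(C), defined by [x] ⊗ 1 ↦ [id_x], is an injective k-linear map. -/

import Mathlib

/-!
For a field `k` and a `k`-linear category `C`, the zeroth Hochschild homology (trace) is
`HH₀(C) := (⨁ x : C, End x) / span_k { f∘g - g∘f }`.  For an additive category `C`, the
split Grothendieck group `K₀(C)` is the quotient of the free abelian group on the
isomorphism classes of objects by the relations `[x ⊕ y] = [x] + [y]`.  The Chern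
character is the `k`-linear map `h : K₀(C) ⊗_ℤ k → HH₀(C)` determined by
`[x] ⊗ 1 ↦ [id_x]` (below we write the tensor product as `k ⊗[ℤ] K₀(C)`).

STATEMENT: if `k` is a perfect field and `C` is a `k`-linear additive Krull–Schmidt
category all of whose endomorphism algebras are finite-dimensional over `k`, then the
Chern character is injective.
-/

open CategoryTheory CategoryTheory.Limits
open scoped DirectSum Classical TensorProduct

/-- The set of commutators `f∘g - g∘f` (for `f : x ⟶ y`, `g : y ⟶ x`) inside `⨁ x : C, End x`. -/
noncomputable def hhCommutators (K : Type*) [CommRing K] (C : Type*) [Category C]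
    [Preadditive C] [Linear K C] : Set (⨁ x : C, (x ⟶ x)) :=
  { v | ∃ (x y : C) (f : x ⟶ y) (g : y ⟶ x),
      v = DirectSum.of (fun z : C => z ⟶ z) y (g ≫ f)
        - DirectSum.of (fun z : C => z ⟶ z) x (f ≫ g) }

/-- The zeroth Hochschild homology (trace) of a `K`-linear category. -/
noncomputable abbrev HH0 (K : Type*) [CommRing K] (C : Type*) [Category C]
    [Preadditive C] [Linear K C] :=
  (⨁ x : C, (x ⟶ x)) ⧸ Submodule.span K (hhCommutators K C)

/-- The class `[f] ∈ HH₀(C)` of an endomorphism `f : x ⟶ x`. -/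
noncomputable def HH0.cls (K : Type*) [CommRing K] {C : Type*} [Category C]
    [Preadditive C] [Linear K C] {x : C} (f : x ⟶ x) : HH0 K C :=
  Submodule.Quotient.mk (DirectSum.of (fun z : C => z ⟶ z) x f)

/-- The subgroup of relations `[x ⊕ y] - [x] - [y]` in the free abelian group on the
isomorphism classes of objects of an additive category. -/
noncomputable def biprodRelations (C : Type*) [Category C] [Preadditive C]
    [HasBinaryBiproducts C] :
    AddSubgroup (FreeAbelianGroup (Quotient (isIsomorphicSetoid C))) :=
  AddSubgroup.closure
    { a | ∃ x y : C,
        a = FreeAbelianGroup.of (Quotient.mk (isIsomorphicSetoid C) (x ⊞ y))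
          - FreeAbelianGroup.of (Quotient.mk (isIsomorphicSetoid C) x)
          - FreeAbelianGroup.of (Quotient.mk (isIsomorphicSetoid C) y) }

/-- The split Grothendieck group of an additive category. -/
noncomputable abbrev K0 (C : Type*) [Category C] [Preadditive C] [HasBinaryBiproducts C] :=
  FreeAbelianGroup (Quotient (isIsomorphicSetoid C)) ⧸ biprodRelations C

/-- The class `[x] ∈ K₀(C)` of an object `x`. -/
noncomputable def K0.cls {C : Type*} [Category C] [Preadditive C] [HasBinaryBiproducts C]
    (x : C) : K0 C :=
  QuotientAddGroup.mk (FreeAbelianGroup.of (Quotient.mk (isIsomorphicSetoid C) x))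

/-- An object of an additive category is indecomposable if it is nonzero and not isomorphic
to a direct sum of two nonzero objects. -/
def IndecomposableObj {C : Type*} [Category C] [Preadditive C] [HasBinaryBiproducts C]
    (x : C) : Prop :=
  ¬IsZero x ∧ ∀ y z : C, Nonempty (x ≅ y ⊞ z) → IsZero y ∨ IsZero z

universe v

/-- The additive subgroup generated by ring commutators. -/
def ringComm (R : Type*) [Ring R] : AddSubgroup R :=
  AddSubgroup.closure {z | ∃ a b : R, z = a * b - b * a}

theorem ringComm_map {R S : Type*} [Ring R] [Ring S] (f : R →+* S) {z : R}
    (hz : z ∈ ringComm R) : f z ∈ ringComm S := by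
  unfold ringComm at hz
  induction hz using AddSubgroup.closure_induction with
  | mem x hx =>
    obtain ⟨a, b, rfl⟩ := hx
    exact AddSubgroup.subset_closure ⟨f a, f b, by simp⟩
  | zero => simp [zero_mem]
  | add x y _ _ hx hy => rw [map_add]; exact add_mem hx hy
  | neg x _ hx => rw [map_neg]; exact neg_mem hx

theorem ringComm_trace {D : Type*} [Ring D] {r : ℕ} {z : Matrix (Fin r) (Fin r) D}
    (hz : z ∈ ringComm (Matrix (Fin r) (Fin r) D)) : z.trace ∈ ringComm D := by
  unfold ringComm at hz
  induction hz using AddSubgroup.closure_induction with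
  | mem x hx =>
    obtain ⟨a, b, rfl⟩ := hx
    have : (a * b - b * a).trace = ∑ i, ∑ j, (a i j * b j i - b j i * a i j) := by
      simp only [Finset.sum_sub_distrib]
      rw [Matrix.trace_sub, Finset.sum_comm (f := fun i j => b j i * a i j)]
      simp [Matrix.trace, Matrix.mul_apply]
    rw [this]
    exact sum_mem fun i _ => sum_mem fun j _ => AddSubgroup.subset_closure ⟨_, _, rfl⟩
  | zero => simp [zero_mem]
  | add x y _ _ hx hy => rw [Matrix.trace_add]; exact add_mem hx hy
  | neg x _ hx => rw [Matrix.trace_neg]; exact neg_mem hx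

theorem one_mem_of_natCast_mem {D : Type*} [Ring D] (p r : ℕ) [CharP D p]
    (hpr : Nat.Coprime r p) (h : (r : D) ∈ ringComm D) : (1 : D) ∈ ringComm D := by
  have h1 := Nat.gcd_eq_gcd_ab r p
  rw [hpr] at h1
  have h2 : (1 : D) = (r.gcdA p) • (r : D) := by
    have := congrArg (Int.cast : ℤ → D) h1
    push_cast at this
    rw [CharP.cast_eq_zero D p] at this
    rw [zsmul_eq_mul]
    simpa [Nat.cast_comm] using this
  rw [h2]
  exact zsmul_mem h _

theorem artin_whaples (L D : Type*) [Field L] [DivisionRing D] [Algebra L D]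
    (hc : ∀ z : D, (∀ w, z * w = w * z) → ∃ l : L, algebraMap L D l = z)
    {ι : Type*} [Fintype ι] (N : AddSubgroup (ι → D))
    (hl : ∀ (c : D) (v), v ∈ N → (fun i => c * v i) ∈ N)
    (hr : ∀ (c : D) (v), v ∈ N → (fun i => v i * c) ∈ N)
    (v : ι → D) (hv : v ∈ N) (hv0 : v ≠ 0) :
    ∃ l : ι → L, l ≠ 0 ∧ (fun i => algebraMap L D (l i)) ∈ N := by
  classical
  induction hn : (Finset.univ.filter fun i => v i ≠ 0).card using Nat.strong_induction_on
    generalizing v with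
  | _ n ih =>
    obtain ⟨i0, hi0⟩ := Function.ne_iff.mp hv0
    simp only [Pi.zero_apply] at hi0
    set u : ι → D := fun i => (v i0)⁻¹ * v i with hu
    have huN : u ∈ N := hl _ _ hv
    have hu1 : u i0 = 1 := by simp [hu, hi0]
    by_cases hcen : ∀ i w, u i * w = w * u i
    · choose l hl' using fun i => hc (u i) (hcen i)
      refine ⟨l, ?_, ?_⟩
      · intro h0
        have := hl' i0
        rw [h0, hu1] at this
        simp at this
      · simpa [hl'] using huN
    · push Not at hcen
      obtain ⟨j, w, hjw⟩ := hcen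
      refine ih _ ?_ (fun i => u i * w - w * u i) (sub_mem (hr w _ huN) (hl w _ huN)) ?_ rfl
      · rw [← hn]
        apply Finset.card_lt_card
        rw [Finset.ssubset_iff_of_subset]
        · exact ⟨i0, by simpa using hi0, by simp [hu1]⟩
        · intro i hi
          simp only [Finset.mem_filter, Finset.mem_univ, true_and] at hi ⊢
          intro h0
          apply hi
          simp [hu, h0]
      · intro h0
        have := congrFun h0 j
        simp only [Pi.zero_apply] at this
        exact hjw (sub_eq_zero.mp this)

theorem tensor_simple (L D M : Type*) [Field L] [DivisionRing D] [Algebra L D] [Field M]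
    [Algebra L M] [FiniteDimensional L M]
    (hc : ∀ z : D, (∀ w, z * w = w * z) → ∃ l : L, algebraMap L D l = z) :
    IsSimpleRing (D ⊗[L] M) := by
  rw [isSimpleRing_iff_isTwoSided_imp]
  refine ⟨inferInstance, fun I hI => ?_⟩
  by_cases hb : I = ⊥
  · exact Or.inl hb
  right
  obtain ⟨z, hz, hz0⟩ := Submodule.exists_mem_ne_zero_of_ne_bot hb
  let b := Module.finBasis L M
  let B := Algebra.TensorProduct.basis D b
  let N : AddSubgroup (Fin (Module.finrank L M) → D) :=
    { carrier := {v | ∑ i, v i ⊗ₜ[L] b i ∈ I}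
      add_mem' := by
        intro v w hv hw
        simp only [Set.mem_ofPred_eq, Pi.add_apply, TensorProduct.add_tmul,
          Finset.sum_add_distrib] at *
        exact add_mem hv hw
      zero_mem' := by simp
      neg_mem' := by
        intro v hv
        simp only [Set.mem_ofPred_eq, Pi.neg_apply, TensorProduct.neg_tmul,
          Finset.sum_neg_distrib] at *
        exact neg_mem hv }
  have hmem : ∀ v, v ∈ N ↔ ∑ i, v i ⊗ₜ[L] b i ∈ I := fun v => Iff.rfl
  have hzs : ∑ i, (B.repr z i) ⊗ₜ[L] b i = z := by
    conv_rhs => rw [← B.sum_repr z]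
    refine Finset.sum_congr rfl fun i _ => ?_
    simp [B, TensorProduct.smul_tmul']
  obtain ⟨l, hl0, hl⟩ := artin_whaples L D hc N
    (by
      intro c v hv
      rw [hmem] at *
      have := I.mul_mem_left (c ⊗ₜ[L] (1 : M)) hv
      simpa [Finset.mul_sum] using this)
    (by
      intro c v hv
      rw [hmem] at *
      have := I.mul_mem_right (c ⊗ₜ[L] (1 : M)) hv
      simpa [Finset.sum_mul] using this)
    (fun i => B.repr z i) (by rw [hmem, hzs]; exact hz)
    (by
      intro h0
      apply hz0
      rw [← hzs]
      refine Finset.sum_eq_zero fun i _ => ?_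
      have := congrFun h0 i
      simp only [Pi.zero_apply] at this
      rw [this, TensorProduct.zero_tmul])
  rw [hmem] at hl
  have hw : ∑ i, (algebraMap L D (l i)) ⊗ₜ[L] b i = (1 : D) ⊗ₜ[L] (∑ i, l i • b i) := by
    rw [TensorProduct.tmul_sum]
    refine Finset.sum_congr rfl fun i _ => ?_
    rw [Algebra.algebraMap_eq_smul_one, TensorProduct.smul_tmul]
  rw [hw] at hl
  have hne : ∑ i, l i • b i ≠ 0 := by
    intro h0
    apply hl0
    funext i
    exact Fintype.linearIndependent_iff.mp b.linearIndependent l h0 i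
  rw [Ideal.eq_top_iff_one]
  have := I.mul_mem_left ((1 : D) ⊗ₜ[L] (∑ i, l i • b i)⁻¹) hl
  rw [Algebra.TensorProduct.tmul_mul_tmul, one_mul, inv_mul_cancel₀ hne] at this
  exact this

/-- Conjugacy of two roots of the same minimal polynomial. -/
theorem exists_conj (L D : Type*) [Field L] [DivisionRing D] [Algebra L D]
    [FiniteDimensional L D]
    (hc : ∀ z : D, (∀ w, z * w = w * z) → ∃ l : L, algebraMap L D l = z)
    (x x' : D) (hx' : Polynomial.aeval x' (minpoly L x) = 0) :
    ∃ y : D, y ≠ 0 ∧ x' * y = y * x := by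
  set g := minpoly L x with hg
  have hint : IsIntegral L x := Algebra.IsIntegral.isIntegral x
  set n := g.natDegree with hn
  have hmon : g.Monic := minpoly.monic hint
  have hnpos : 0 < n := minpoly.natDegree_pos hint
  let G : ℕ → D := fun j => Polynomial.aeval x' (Polynomial.divX^[j] g)
  have hcoeff : ∀ j i, (Polynomial.divX^[j] g).coeff i = g.coeff (i + j) := by
    intro j
    induction j with
    | zero => simp
    | succ j ih =>
      intro i
      rw [Function.iterate_succ_apply', Polynomial.coeff_divX, ih]
      congr 1; ring
  have hG : ∀ j, G j = x' * G (j+1) + algebraMap L D (g.coeff j) := by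
    intro j
    have h1 := Polynomial.divX_mul_X_add (Polynomial.divX^[j] g)
    simp only [G]
    conv_lhs => rw [← h1]
    rw [hcoeff, Function.iterate_succ_apply', mul_comm]
    simp
  have hG0 : G 0 = 0 := hx'
  have hGn : G n = 1 := by
    have : Polynomial.divX^[n] g = 1 := by
      ext i
      rw [hcoeff]
      rcases i with _ | i
      · rw [zero_add, Polynomial.coeff_one_zero]; exact hmon
      · rw [Polynomial.coeff_eq_zero_of_natDegree_lt (by omega), Polynomial.coeff_one]
        simp
    simp [G, this]
  -- the intertwining identity
  have hint2 : ∀ d : D, x' * (∑ j ∈ Finset.range n, G (j+1) * d * x ^ j)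
      = (∑ j ∈ Finset.range n, G (j+1) * d * x ^ j) * x := by
    intro d
    have hz : ∑ j ∈ Finset.range (n+1), algebraMap L D (g.coeff j) * d * x ^ j = 0 := by
      have h1 : Polynomial.aeval x g = 0 := minpoly.aeval L x
      rw [Polynomial.aeval_eq_sum_range] at h1
      have h2 := congrArg (fun z => d * z) h1
      simp only [mul_zero, Finset.mul_sum] at h2
      rw [← h2]
      refine Finset.sum_congr rfl fun j _ => ?_
      rw [Algebra.commutes, mul_assoc, Algebra.smul_def]
    have h1 : x' * (∑ j ∈ Finset.range n, G (j+1) * d * x ^ j)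
        = ∑ j ∈ Finset.range n, (G j * d * x ^ j - algebraMap L D (g.coeff j) * d * x ^ j) := by
      rw [Finset.mul_sum]
      refine Finset.sum_congr rfl fun j _ => ?_
      rw [hG j]; noncomm_ring
    have h3 : ∑ j ∈ Finset.range (n+1), G j * d * x ^ j
        = (∑ j ∈ Finset.range n, G (j+1) * d * x ^ j) * x := by
      rw [Finset.sum_range_succ', hG0, Finset.sum_mul]
      simp [pow_succ, mul_assoc]
    rw [h1, Finset.sum_sub_distrib, ← h3, Finset.sum_range_succ]
    rw [Finset.sum_range_succ] at hz
    have h4 : algebraMap L D (g.coeff n) = 1 := by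
      have : g.coeff n = 1 := hmon
      simp [this]
    rw [h4] at hz
    rw [hGn, sub_eq_iff_eq_add, add_assoc, add_comm (1 * d * x ^ n), hz, add_zero]
  by_contra hcon
  push Not at hcon
  have hall : ∀ d : D, ∑ j ∈ Finset.range n, G (j+1) * d * x ^ j = 0 := by
    intro d
    by_contra h0
    exact hcon _ h0 (hint2 d)
  let N : AddSubgroup (Fin n → D) :=
    { carrier := {v | ∀ d, ∑ j, v j * d * x ^ (j : ℕ) = 0}
      add_mem' := by
        intro v w hv hw d
        simp only [Set.mem_ofPred_eq] at hv hw
        simp [add_mul, Finset.sum_add_distrib, hv d, hw d]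
      zero_mem' := by simp
      neg_mem' := by
        intro v hv d
        simp only [Set.mem_ofPred_eq] at hv
        simp [hv d] }
  have hmem : ∀ v, v ∈ N ↔ ∀ d, ∑ j, v j * d * x ^ (j : ℕ) = 0 := fun v => Iff.rfl
  obtain ⟨l, hl0, hl⟩ := artin_whaples L D hc N
    (by
      intro c v hv d
      simp only [mul_assoc]
      rw [← Finset.mul_sum]
      have := (hmem v).1 hv d
      simp only [mul_assoc] at this
      rw [this, mul_zero])
    (by
      intro c v hv d
      have := (hmem v).1 hv (c * d)
      simpa [mul_assoc] using this)
    (fun j => G (j+1)) (by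
      rw [hmem]; intro d
      rw [← hall d, Finset.sum_range]) (by
      intro h0
      have := congrFun h0 ⟨n-1, by omega⟩
      simp only [Pi.zero_apply] at this
      rw [show n - 1 + 1 = n by omega, hGn] at this
      exact one_ne_zero this)
  have hl1 := (hmem _).1 hl 1
  have hli := linearIndependent_pow (K := L) x
  rw [Fintype.linearIndependent_iff] at hli
  apply hl0
  funext i
  refine hli l ?_ i
  simpa [Algebra.smul_def] using hl1

theorem mem_pow_poly (L D : Type*) [Field L] [PerfectField L] [DivisionRing D] [Algebra L D]
    [FiniteDimensional L D] (p : ℕ) [Fact p.Prime] [CharP L p] (y : D) (s : ℕ) :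
    ∃ u : Polynomial L, Polynomial.aeval (y ^ p ^ s) u = y := by
  have hint : IsIntegral L y := Algebra.IsIntegral.isIntegral y
  have : Fact (Irreducible (minpoly L y)) := ⟨minpoly.irreducible hint⟩
  let E := AdjoinRoot (minpoly L y)
  let a : E := AdjoinRoot.root _
  have : ExpChar L p := ExpChar.prime Fact.out
  have haint : IsIntegral L a := AdjoinRoot.isIntegral_root (minpoly.ne_zero hint)
  have : FiniteDimensional L E :=
    (AdjoinRoot.powerBasis (minpoly.ne_zero hint)).finite
  have h := IntermediateField.adjoin_simple_eq_adjoin_pow_expChar_pow_of_isSeparable' L E a p s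
  have hmem : a ∈ IntermediateField.adjoin L {a ^ p ^ s} := by
    rw [← h]; exact IntermediateField.mem_adjoin_simple_self L a
  rw [← IntermediateField.mem_toSubalgebra,
    IntermediateField.adjoin_simple_toSubalgebra_of_isAlgebraic (haint.pow _).isAlgebraic,
    Algebra.adjoin_singleton_eq_range_aeval] at hmem
  obtain ⟨u, hu⟩ := hmem
  refine ⟨u, ?_⟩
  have h1 : AdjoinRoot.mk (minpoly L y)
      (Polynomial.expand L (p ^ s) u - Polynomial.X) = 0 := by
    rw [← AdjoinRoot.aeval_eq, map_sub, Polynomial.expand_aeval, Polynomial.aeval_X, sub_eq_zero]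
    exact hu
  rw [AdjoinRoot.mk_eq_zero, minpoly.dvd_iff, map_sub, Polynomial.expand_aeval,
    Polynomial.aeval_X, sub_eq_zero] at h1
  exact h1

theorem galois_step (L D M : Type*) [Field L] [PerfectField L] [DivisionRing D] [Algebra L D]
    [FiniteDimensional L D] (p : ℕ) [Fact p.Prime] [CharP L p]
    (hc : ∀ z : D, (∀ w, z * w = w * z) → ∃ l : L, algebraMap L D l = z)
    [Field M] [Algebra L M] [FiniteDimensional L M] [IsGalois L M]
    (hP : IsPGroup p (M ≃ₐ[L] M)) (x : D) (hx : ∀ l : L, algebraMap L D l ≠ x)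
    (hs : ((minpoly L x).map (algebraMap L M)).Splits) : False := by
  have hint : IsIntegral L x := Algebra.IsIntegral.isIntegral x
  set g := minpoly L x with hg
  have hirr : Irreducible g := minpoly.irreducible hint
  have hmon : g.Monic := minpoly.monic hint
  obtain ⟨β, hβ⟩ := hs.exists_eval_eq_zero (by
    rw [Polynomial.degree_map]; exact (minpoly.degree_pos hint).ne')
  have hβ' : Polynomial.aeval β g = 0 := by
    rwa [Polynomial.eval_map_algebraMap] at hβ
  have hgβ : g = minpoly L β := minpoly.eq_of_irreducible_of_monic hirr hβ' hmon
  have htrans : ∀ F : Polynomial L, Polynomial.aeval β F = 0 ↔ Polynomial.aeval x F = 0 := by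
    intro F
    rw [← minpoly.dvd_iff, ← minpoly.dvd_iff, ← hgβ]
  have hβL : ∀ l : L, algebraMap L M l ≠ β := by
    intro l hl
    have h1 := (htrans (Polynomial.X - Polynomial.C l)).1 (by simp [hl])
    apply hx l
    simp only [map_sub, Polynomial.aeval_X, Polynomial.aeval_C] at h1
    exact (sub_eq_zero.mp h1).symm
  let K := IntermediateField.adjoin L {β}
  let H := K.fixingSubgroup
  have hH : ∀ τ : M ≃ₐ[L] M, τ ∈ H ↔ τ β = β := by
    intro τ
    constructor
    · intro h
      exact (IntermediateField.mem_fixingSubgroup_iff K τ).1 h β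
        (IntermediateField.mem_adjoin_simple_self L β)
    · intro h
      rw [← Subgroup.zpowers_le]
      rw [← IntermediateField.le_iff_le, IntermediateField.adjoin_simple_le_iff,
        IntermediateField.mem_fixedField_iff]
      intro f hf
      have : Subgroup.zpowers τ ≤ MulAction.stabilizer (M ≃ₐ[L] M) β := by
        rw [Subgroup.zpowers_le]
        exact h
      exact this hf
  have hfix : IntermediateField.fixedField H = K := IsGalois.fixedField_fixingSubgroup K
  have hHtop : H < ⊤ := by
    rw [lt_top_iff_ne_top]
    intro htop
    have h1 : β ∈ IntermediateField.fixedField (⊤ : Subgroup (M ≃ₐ[L] M)) := by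
      rw [← htop, hfix]
      exact IntermediateField.mem_adjoin_simple_self L β
    rw [IsGalois.fixedField_top, IntermediateField.mem_bot] at h1
    obtain ⟨l, hl⟩ := h1
    exact hβL l hl
  have hnil : Group.IsNilpotent (M ≃ₐ[L] M) := hP.isNilpotent
  have hlt := Group.normalizerCondition_of_isNilpotent H hHtop
  obtain ⟨τ, hτN, hτH⟩ := SetLike.exists_of_lt hlt
  have hτβ : τ β ≠ β := fun h => hτH ((hH τ).2 h)
  have hτK : τ β ∈ K := by
    rw [← hfix, IntermediateField.mem_fixedField_iff]
    intro h hh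
    have h2 : τ⁻¹ * h * τ ∈ H := by
      rw [Subgroup.mem_normalizer_iff''] at hτN
      exact (hτN h).1 hh
    rw [hH] at h2
    have h3 := congrArg τ h2
    simpa [AlgEquiv.mul_apply] using h3
  obtain ⟨q, hq⟩ : ∃ q : Polynomial L, Polynomial.aeval β q = τ β := by
    have h1 : τ β ∈ K.toSubalgebra := hτK
    rw [IntermediateField.adjoin_simple_toSubalgebra_of_isAlgebraic
      (Algebra.IsAlgebraic.isAlgebraic β), Algebra.adjoin_singleton_eq_range_aeval] at h1
    exact h1
  obtain ⟨s, hs'⟩ := hP τ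
  obtain ⟨y, hy0, hy⟩ := exists_conj L D hc x (Polynomial.aeval x q) (by
    rw [← Polynomial.aeval_comp, ← htrans, Polynomial.aeval_comp, hq]
    have : Polynomial.aeval (τ β) g = τ (Polynomial.aeval β g) :=
      Polynomial.aeval_algHom_apply τ.toAlgHom β g
    rw [← hg, this, hβ', map_zero])
  have hyF : ∀ F : Polynomial L, Polynomial.aeval (Polynomial.aeval x q) F * y
      = y * Polynomial.aeval x F := by
    intro F
    induction F using Polynomial.induction_on' with
    | add F G hF hG => simp [add_mul, mul_add, hF, hG]
    | monomial n a =>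
      have hpow : (Polynomial.aeval x q) ^ n * y = y * x ^ n :=
        (show SemiconjBy y x (Polynomial.aeval x q) from hy.symm).pow_right n |>.eq.symm
      rw [Polynomial.aeval_monomial, Polynomial.aeval_monomial, mul_assoc, hpow, ← mul_assoc,
        Algebra.commutes, mul_assoc]
  have hiter : ∀ j : ℕ, ∃ Q : Polynomial L, Polynomial.aeval β Q = (τ ^ j) β ∧
      Polynomial.aeval x Q * y ^ j = y ^ j * x := by
    intro j
    induction j with
    | zero => exact ⟨Polynomial.X, by simp⟩
    | succ j ih =>
      obtain ⟨Q, hQ1, hQ2⟩ := ih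
      refine ⟨Q.comp q, ?_, ?_⟩
      · rw [Polynomial.aeval_comp, hq]
        have : Polynomial.aeval (τ β) Q = τ (Polynomial.aeval β Q) :=
          Polynomial.aeval_algHom_apply τ.toAlgHom β Q
        rw [this, hQ1, pow_succ']
        rfl
      · rw [Polynomial.aeval_comp, pow_succ', ← mul_assoc, hyF, mul_assoc, hQ2, mul_assoc]
  obtain ⟨Q, hQ1, hQ2⟩ := hiter (p ^ s)
  rw [hs'] at hQ1
  have hQx : Polynomial.aeval x Q = x := by
    have h1 := (htrans (Q - Polynomial.X)).1 (by simp [hQ1])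
    simpa [sub_eq_zero] using h1
  rw [hQx] at hQ2
  obtain ⟨u, hu⟩ := mem_pow_poly L D p y s
  have hcomm : Commute x y := by
    rw [← hu]
    have : Commute x (y ^ p ^ s) := hQ2
    have hmem : Polynomial.aeval (y ^ p ^ s) u ∈ Algebra.adjoin L {y ^ p ^ s} :=
      Polynomial.aeval_mem_adjoin_singleton L _
    have hle : Algebra.adjoin L {y ^ p ^ s} ≤ Subalgebra.centralizer L {x} := by
      rw [Algebra.adjoin_le_iff, Set.singleton_subset_iff]
      exact (Subalgebra.mem_centralizer_iff L).2
        (fun w hw => by rw [Set.mem_singleton_iff.1 hw]; exact this.eq)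
    have := hle hmem
    rw [Subalgebra.mem_centralizer_iff] at this
    exact this x rfl
  have hqx : Polynomial.aeval x q = x := by
    have h1 : Polynomial.aeval x q * y = x * y := by rw [hy, hcomm.eq]
    exact mul_right_cancel₀ hy0 h1
  have h1 := (htrans (q - Polynomial.X)).2 (by simp [hqx])
  apply hτβ
  rw [← hq]
  simpa [sub_eq_zero] using h1

theorem center_step (L D : Type v) [Field L] [PerfectField L] [DivisionRing D]
    [Algebra L D] [FiniteDimensional L D] (p : ℕ) [CharP L p]
    (ih : ∀ (L' D' : Type v) [Field L'] [PerfectField L'] [DivisionRing D']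
      [Algebra L' D'] [FiniteDimensional L' D'] [CharP L' p],
      Module.finrank L' D' < Module.finrank L D → (1 : D') ∉ ringComm D')
    (h1 : (1 : D) ∈ ringComm D) :
    ∀ z : D, (∀ w, z * w = w * z) → ∃ l : L, algebraMap L D l = z := by
  intro z hz
  by_contra hcon
  push Not at hcon
  let Z := Subring.center D
  let φ : L →+* Z := (algebraMap L D).codRestrict Z (fun l => by
    rw [Subring.mem_center_iff]
    intro g
    exact (Algebra.commutes l g).symm)
  let _ : Algebra L Z := φ.toAlgebra
  have : IsScalarTower L Z D := IsScalarTower.of_algebraMap_eq (fun l => rfl)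
  have : FiniteDimensional L Z := by
    let ψ : Z →ₗ[L] D := (IsScalarTower.toAlgHom L Z D).toLinearMap
    exact FiniteDimensional.of_injective ψ Subtype.val_injective
  have : FiniteDimensional Z D := FiniteDimensional.right L Z D
  have : PerfectField Z := Algebra.IsAlgebraic.perfectField L
  have : CharP Z p := charP_of_injective_algebraMap (algebraMap L Z).injective p
  have hm := Module.finrank_mul_finrank L Z D
  have hpos : 0 < Module.finrank Z D := Module.finrank_pos
  have hlt : 1 < Module.finrank L Z := by
    by_contra hle
    have h2 : Module.finrank L Z = 1 := by
      have : 0 < Module.finrank L Z := Module.finrank_pos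
      omega
    have h3 := (finrank_eq_one_iff_of_nonzero' (1 : Z) one_ne_zero).1 h2
      ⟨z, by rw [Subring.mem_center_iff]; intro g; exact (hz g).symm⟩
    obtain ⟨c, hc⟩ := h3
    apply hcon c
    have := congrArg Subtype.val hc
    rw [Algebra.smul_def] at this
    exact (by simpa using this : ((algebraMap L Z c : Z) : D) = z)
  exact ih Z D (by rw [← hm]; nlinarith) h1

/-- The unique entry of a one by one matrix. -/
def entryHom (R : Type*) [Ring R] : Matrix (Fin 1) (Fin 1) R →+* R where
  toFun m := m 0 0
  map_one' := by simp
  map_mul' a b := by simp [Matrix.mul_apply]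
  map_zero' := rfl
  map_add' _ _ := rfl

/-- Extending scalars along an extension of degree prime to `p`. -/
theorem extension_step (L D M : Type v) [Field L] [PerfectField L] [DivisionRing D]
    [Algebra L D] [FiniteDimensional L D] (p : ℕ) [Fact p.Prime] [CharP L p]
    [Field M] [Algebra L M] [FiniteDimensional L M] (hpm : ¬ p ∣ Module.finrank L M)
    (hc : ∀ z : D, (∀ w, z * w = w * z) → ∃ l : L, algebraMap L D l = z)
    (ih : ∀ (L' D' : Type v) [Field L'] [PerfectField L'] [DivisionRing D']
      [Algebra L' D'] [FiniteDimensional L' D'] [CharP L' p],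
      Module.finrank L' D' < Module.finrank L D → (1 : D') ∉ ringComm D')
    (h1 : (1 : D) ∈ ringComm D) :
    ∃ (D' : Type v) (_ : DivisionRing D') (_ : Algebra M D') (_ : FiniteDimensional M D')
      (j : D →+* D'), Module.finrank M D' = Module.finrank L D ∧
        (1 : D') ∈ ringComm D' ∧
        ∀ l : L, j (algebraMap L D l) = algebraMap M D' (algebraMap L M l) := by
  classical
  let A := M ⊗[L] D
  have hsimple : IsSimpleRing A :=
    IsSimpleRing.of_ringEquiv (Algebra.TensorProduct.comm L D M).toRingEquiv
      (tensor_simple L D M hc)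
  have hfin : FiniteDimensional M A := inferInstance
  have hart : IsArtinianRing A := IsArtinianRing.of_finite M A
  have hss : IsSemisimpleRing A := IsSimpleRing.isSemisimpleRing_iff_isArtinianRing.2 hart
  obtain ⟨n, hn, S, hS, ⟨e⟩⟩ := (IsSimpleRing.isIsotypic A A).linearEquiv_fun
  let D' := (Module.End A S)ᵐᵒᵖ
  have e2 : A ≃ₐ[M] Matrix (Fin n) (Fin n) D' :=
    .trans (.opOp M A) <| .trans (.op (.trans (.moduleEndSelf M) <|
      .trans (e.conjAlgEquiv M) (endVecAlgEquivMatrixEnd ..))) (.symm .mopMatrix)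
  let instD' : DivisionRing D' := inferInstance
  have hfinD' : FiniteDimensional M D' := by
    have := Module.Finite.equiv e2.toLinearEquiv
    exact .of_surjective
      (Matrix.entryLinearMap M _ (0 : Fin n) (0 : Fin n)) fun f ↦ ⟨fun _ _ ↦ f, rfl⟩
  have hrank : n * n * Module.finrank M D' = Module.finrank L D := by
    have h2 := e2.toLinearEquiv.finrank_eq
    rw [Module.finrank_matrix] at h2
    rw [show Module.finrank M A = Module.finrank L D from Module.finrank_baseChange] at h2
    simp at h2
    exact h2.symm
  have hperf : PerfectField M := Algebra.IsAlgebraic.perfectField L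
  have hcharM : CharP M p := charP_of_injective_algebraMap (algebraMap L M).injective p
  have hcharD' : CharP D' p := charP_of_injective_algebraMap (algebraMap M D').injective p
  let incl : D →+* A := (Algebra.TensorProduct.includeRight : D →ₐ[L] A).toRingHom
  have hndvd : n ∣ Module.finrank L M := by
    let _ : Module D S := Module.compHom S incl
    have htow : IsScalarTower L D S := by
      refine ⟨fun l d s => ?_⟩
      change incl (l • d) • s = l • (incl d • s)
      have : incl (l • d) = l • incl d := map_smul (Algebra.TensorProduct.includeRight : D →ₐ[L] A) l d
      rw [this, smul_assoc]
    have hm := Module.finrank_mul_finrank L D S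
    have h3 : Module.finrank L A = n * Module.finrank L S := by
      rw [(e.restrictScalars L).finrank_eq, Module.finrank_pi_fintype]
      simp
    have h4 : Module.finrank L A = Module.finrank L M * Module.finrank L D :=
      Module.finrank_tensorProduct
    have hpos : 0 < Module.finrank L D := Module.finrank_pos
    refine ⟨Module.finrank D S, ?_⟩
    apply Nat.eq_of_mul_eq_mul_right hpos
    rw [← h4, h3, ← hm]; ring
  have hncop : Nat.Coprime n p := by
    rw [Nat.coprime_comm, Nat.Prime.coprime_iff_not_dvd Fact.out]
    exact fun h => hpm (h.trans hndvd)
  have h1D' : (1 : D') ∈ ringComm D' := by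
    have h2 := ringComm_map (e2.toRingEquiv.toRingHom.comp incl) h1
    rw [map_one] at h2
    have h3 := ringComm_trace h2
    rw [Matrix.trace_one, Fintype.card_fin] at h3
    exact one_mem_of_natCast_mem p n hncop h3
  have hn1 : n = 1 := by
    by_contra hne
    have hn2 : 2 ≤ n := by have := hn.out; omega
    have hpos : 0 < Module.finrank M D' := Module.finrank_pos
    have hn4 : 4 ≤ n * n := by nlinarith
    have hn5 := Nat.mul_le_mul_right (Module.finrank M D') hn4
    exact ih M D' (by rw [← hrank]; exact lt_of_lt_of_le (by omega) hn5) h1D'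
  subst hn1
  refine ⟨D', instD', inferInstance, hfinD',
    (entryHom D').comp
      (e2.toRingEquiv.toRingHom.comp incl), by simpa using hrank, h1D', ?_⟩
  intro l
  have h5 : incl (algebraMap L D l) = algebraMap M A (algebraMap L M l) := by
    change (Algebra.TensorProduct.includeRight : D →ₐ[L] A) _ = _
    rw [AlgHom.commutes]
    rfl
  have h6 : e2 (algebraMap M A (algebraMap L M l)) = algebraMap M _ (algebraMap L M l) :=
    e2.commutes _
  change (e2 (incl (algebraMap L D l))) 0 0 = _
  rw [h5, h6, Matrix.algebraMap_matrix_apply]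
  simp

theorem one_not_mem_ringComm_aux (p : ℕ) [Fact p.Prime] (N : ℕ) :
    ∀ (L D : Type v) [Field L] [PerfectField L] [DivisionRing D]
      [Algebra L D] [FiniteDimensional L D] [CharP L p],
      Module.finrank L D = N → (1 : D) ∉ ringComm D := by
  induction N using Nat.strong_induction_on with
  | _ N IH =>
  intro L D _ _ _ _ _ _ hN h1
  have ih : ∀ (L' D' : Type v) [Field L'] [PerfectField L'] [DivisionRing D']
      [Algebra L' D'] [FiniteDimensional L' D'] [CharP L' p],
      Module.finrank L' D' < N → (1 : D') ∉ ringComm D' := by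
    intro L' D' _ _ _ _ _ _ hlt
    exact IH _ hlt L' D' rfl
  have hc := center_step L D p (by rw [hN]; exact ih) h1
  obtain ⟨x, hx⟩ : ∃ x : D, ∀ l : L, algebraMap L D l ≠ x := by
    by_contra hcon
    push Not at hcon
    have hcomm : ∀ a b : D, a * b = b * a := by
      intro a b
      obtain ⟨l, rfl⟩ := hcon a
      exact Algebra.commutes l b
    have : ringComm D = ⊥ := by
      rw [ringComm, AddSubgroup.closure_eq_bot_iff]
      rintro _ ⟨a, b, rfl⟩
      simp [hcomm a b]
    rw [this, AddSubgroup.mem_bot] at h1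
    exact one_ne_zero h1
  have hint : IsIntegral L x := Algebra.IsIntegral.isIntegral x
  let f := minpoly L x
  have hsep : f.Separable := PerfectField.separable_of_irreducible (minpoly.irreducible hint)
  let M := f.SplittingField
  have hgal : IsGalois L M := IsGalois.of_separable_splitting_field hsep
  have hfd : FiniteDimensional L M := inferInstance
  let P : Sylow p (M ≃ₐ[L] M) := default
  let L' := IntermediateField.fixedField (P : Subgroup (M ≃ₐ[L] M))
  have hcardP : Module.finrank L' M = Nat.card P :=
    IntermediateField.finrank_fixedField_eq_card _
  have hpL' : ¬ p ∣ Module.finrank L L' := by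
    have h2 : Module.finrank L L' = (P : Subgroup (M ≃ₐ[L] M)).index := by
      have h3 := Module.finrank_mul_finrank L L' M
      have h4 := (P : Subgroup (M ≃ₐ[L] M)).index_mul_card
      rw [IsGalois.card_aut_eq_finrank, ← h3, hcardP] at h4
      exact (Nat.eq_of_mul_eq_mul_right Nat.card_pos h4).symm
    rw [h2]
    exact P.not_dvd_index
  obtain ⟨D', _, _, _, j, hrk, h1', hj⟩ :=
    extension_step L D L' p hpL' hc (by rw [hN]; exact ih) h1
  have hperf : PerfectField L' := Algebra.IsAlgebraic.perfectField L
  have hchar : CharP L' p := charP_of_injective_algebraMap (algebraMap L L').injective p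
  have hc' := center_step L' D' p (by rw [hrk, hN]; exact ih) h1'
  have hPg : IsPGroup p (M ≃ₐ[L'] M) := by
    obtain ⟨n, hn⟩ := IsPGroup.iff_card.1 P.isPGroup'
    apply IsPGroup.of_card (n := n)
    rw [IsGalois.card_aut_eq_finrank, hcardP]
    exact hn
  refine galois_step L' D' M p hc' hPg (j x) ?_ ?_
  · intro l hl
    obtain ⟨l0, hl0⟩ := hc x (fun w => by
      apply j.injective
      rw [map_mul, map_mul, ← hl, Algebra.commutes])
    exact hx l0 hl0
  · have hdvd : minpoly L' (j x) ∣ f.map (algebraMap L L') := by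
      rw [minpoly.dvd_iff, Polynomial.aeval_def, Polynomial.eval₂_map]
      have h2 : (algebraMap L' D').comp (algebraMap L L') = j.comp (algebraMap L D) := by
        ext l; exact (hj l).symm
      rw [h2, ← Polynomial.hom_eval₂, ← Polynomial.aeval_def, minpoly.aeval, map_zero]
    have hspl : (f.map (algebraMap L M)).Splits := Polynomial.SplittingField.splits f
    have hd2 : (minpoly L' (j x)).map (algebraMap L' M) ∣ f.map (algebraMap L M) := by
      have := Polynomial.map_dvd (algebraMap L' M) hdvd
      rwa [Polynomial.map_map, ← IsScalarTower.algebraMap_eq] at this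
    refine hspl.of_dvd ?_ hd2
    exact Polynomial.map_ne_zero (minpoly.ne_zero hint)

theorem one_not_mem_ringComm (k : Type*) (D : Type v) [Field k] [PerfectField k] [DivisionRing D]
    [Algebra k D] [FiniteDimensional k D] : (1 : D) ∉ ringComm D := by
  intro h1
  by_cases h0 : CharZero k
  · let T : D →+ k := (LinearMap.trace k D).toAddMonoidHom.comp
      (LinearMap.mul k D).toAddMonoidHom
    have hT : ringComm D ≤ T.ker := by
      rw [ringComm, AddSubgroup.closure_le]
      rintro _ ⟨a, b, rfl⟩
      change LinearMap.trace k D (LinearMap.mulLeft k (a * b - b * a)) = 0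
      have : LinearMap.mulLeft k (a * b - b * a) =
          LinearMap.mulLeft k a * LinearMap.mulLeft k b -
          LinearMap.mulLeft k b * LinearMap.mulLeft k a := by
        ext z; simp [sub_mul, mul_assoc]
      rw [this, map_sub, LinearMap.trace_mul_comm, sub_self]
    have h2 : LinearMap.trace k D (LinearMap.mulLeft k 1) = 0 := hT h1
    rw [LinearMap.mulLeft_one] at h2
    have h3 := LinearMap.trace_one k D
    rw [Module.End.one_eq_id, h2] at h3
    have : 0 < Module.finrank k D := Module.finrank_pos
    exact this.ne' (by exact_mod_cast h3.symm)
  · obtain ⟨p, hp⟩ := CharP.exists k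
    have hpp : p.Prime := by
      rcases CharP.char_is_prime_or_zero k p with h | h
      · exact h
      · subst h
        exact absurd (CharP.charP_to_charZero k) h0
    have : Fact p.Prime := ⟨hpp⟩
    let Z := Subring.center D
    let φ : k →+* Z := (algebraMap k D).codRestrict Z (fun l => by
      rw [Subring.mem_center_iff]
      intro g
      exact (Algebra.commutes l g).symm)
    let _ : Algebra k Z := φ.toAlgebra
    have : IsScalarTower k Z D := IsScalarTower.of_algebraMap_eq (fun l => rfl)
    have : FiniteDimensional k Z := by
      let ψ : Z →ₗ[k] D := (IsScalarTower.toAlgHom k Z D).toLinearMap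
      exact FiniteDimensional.of_injective ψ Subtype.val_injective
    have : FiniteDimensional Z D := FiniteDimensional.right k Z D
    have : PerfectField Z := Algebra.IsAlgebraic.perfectField k
    have : CharP Z p := charP_of_injective_algebraMap (algebraMap k Z).injective p
    exact one_not_mem_ringComm_aux p _ Z D rfl h1

theorem exists_local_functional (k : Type*) (R : Type v) [Field k] [PerfectField k] [Ring R]
    [Algebra k R] [FiniteDimensional k R] [IsLocalRing R] :
    ∃ φ : R →ₗ[k] k, φ 1 = 1 ∧ (∀ a b, φ (a * b) = φ (b * a)) ∧
      ∀ a, ¬ IsUnit a → φ a = 0 := by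
  have hart : IsArtinianRing R := IsArtinianRing.of_finite k R
  have hded : ∀ a b : R, a * b = 1 → b * a = 1 := by
    intro a b hab
    have hid : (b * a) * (b * a) = b * a := by
      calc (b * a) * (b * a) = b * (a * b) * a := by noncomm_ring
        _ = b * a := by rw [hab, mul_one]
    rcases IsLocalRing.isUnit_or_isUnit_of_add_one (a := b * a) (b := 1 - b * a)
      (by abel) with h | h
    · exact h.mul_left_cancel (by rw [hid, mul_one])
    · have h2 : b * a = 0 := h.mul_left_cancel (by rw [sub_mul, hid, one_mul, sub_self, mul_zero])
      exfalso
      have h3 : (1 : R) = a * (b * a) * b := by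
        calc (1 : R) = (a * b) * (a * b) := by rw [hab, one_mul]
          _ = a * (b * a) * b := by noncomm_ring
      rw [h2, mul_zero, zero_mul] at h3
      exact one_ne_zero h3
  have hleft : ∀ a b : R, a * b = 1 → IsUnit a ∧ IsUnit b := by
    intro a b hab
    exact ⟨⟨⟨a, b, hab, hded a b hab⟩, rfl⟩, ⟨⟨b, a, hded a b hab, hab⟩, rfl⟩⟩
  have hmul : ∀ a b : R, IsUnit (a * b) → IsUnit a ∧ IsUnit b := by
    rintro a b ⟨u, hu⟩
    constructor
    · refine (hleft a (b * ↑u⁻¹) ?_).1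
      rw [← mul_assoc, ← hu, Units.mul_inv]
    · refine (hleft (↑u⁻¹ * a) b ?_).2
      rw [mul_assoc, ← hu, Units.inv_mul]
  let J : Ideal R :=
    { carrier := {a | ¬ IsUnit a}
      zero_mem' := by
        change ¬ IsUnit (0 : R)
        exact not_isUnit_zero
      add_mem' := by
        intro a b ha hb hab
        obtain ⟨u, hu⟩ := hab
        have h1 : ↑u⁻¹ * a + ↑u⁻¹ * b = 1 := by rw [← mul_add, ← hu, Units.inv_mul]
        rcases IsLocalRing.isUnit_or_isUnit_of_add_one h1 with h | h
        · exact ha (hmul _ _ h).2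
        · exact hb (hmul _ _ h).2
      smul_mem' := by
        intro c a ha h
        exact ha (hmul _ _ h).2 }
  have hJ : ∀ a, a ∈ J ↔ ¬ IsUnit a := fun a => Iff.rfl
  have hts : J.IsTwoSided := ⟨fun {a} b ha h => ha (hmul _ _ h).1⟩
  let Q := R ⧸ J
  have hJ1 : J ≠ ⊤ := by
    rw [Ideal.ne_top_iff_one, hJ, not_not]; exact isUnit_one
  have hnt : Nontrivial Q := Ideal.Quotient.nontrivial_iff.2 hJ1
  have hunit : ∀ a : Q, IsUnit a ∨ a = 0 := by
    intro a
    obtain ⟨r, rfl⟩ := Ideal.Quotient.mk_surjective a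
    by_cases h : IsUnit r
    · exact Or.inl (h.map _)
    · exact Or.inr (Ideal.Quotient.eq_zero_iff_mem.2 h)
  let instQ : DivisionRing Q := DivisionRing.ofIsUnitOrEqZero hunit
  have hfdQ : FiniteDimensional k Q :=
    Module.Finite.of_surjective (Ideal.Quotient.mkₐ k J).toLinearMap
      (Ideal.Quotient.mkₐ_surjective k J)
  have h1 : (1 : Q) ∉ ringComm Q := one_not_mem_ringComm k Q
  let W : Submodule k Q :=
    { ringComm Q with
      smul_mem' := by
        intro c z hz
        change z ∈ ringComm Q at hz
        change c • z ∈ ringComm Q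
        unfold ringComm at hz
        induction hz using AddSubgroup.closure_induction with
        | mem x hx =>
          obtain ⟨a, b, rfl⟩ := hx
          exact AddSubgroup.subset_closure ⟨c • a, b, by simp [smul_sub]⟩
        | zero => rw [smul_zero]; exact zero_mem _
        | add x y _ _ hx hy => rw [smul_add]; exact add_mem hx hy
        | neg x _ hx => rw [smul_neg]; exact neg_mem hx }
  have h1W : (1 : Q) ∉ W := h1
  obtain ⟨ψ, hψ1, hψ⟩ := Submodule.exists_le_ker_of_notMem h1W
  let π : R →ₗ[k] Q := (Ideal.Quotient.mkₐ k J).toLinearMap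
  have hπ : ∀ r, π r = Ideal.Quotient.mk J r := fun r => rfl
  refine ⟨(ψ 1)⁻¹ • (ψ.comp π), ?_, ?_, ?_⟩
  · rw [LinearMap.smul_apply, LinearMap.comp_apply, hπ, map_one (Ideal.Quotient.mk J), smul_eq_mul]
    exact inv_mul_cancel₀ hψ1
  · intro a b
    simp only [LinearMap.smul_apply, LinearMap.comp_apply, hπ]
    congr 1
    rw [← sub_eq_zero, ← map_sub, map_mul, map_mul]
    exact hψ (AddSubgroup.subset_closure ⟨_, _, rfl⟩)
  · intro a ha
    simp only [LinearMap.smul_apply, LinearMap.comp_apply, hπ]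
    rw [Ideal.Quotient.eq_zero_iff_mem.2 ha, map_zero, smul_zero]

theorem retract_iso {C : Type*} [Category C] [Preadditive C] (x w : C)
    [IsLocalRing (End x)] [IsLocalRing (End w)] (a : x ⟶ w) (b : w ⟶ x)
    (h : IsUnit (M := End x) (a ≫ b)) : Nonempty (w ≅ x) := by
  obtain ⟨u, hu⟩ := h
  let ui : x ⟶ x := (↑u⁻¹ : End x)
  have h1 : a ≫ b ≫ ui = 𝟙 x := by
    have : (↑u⁻¹ : End x) * ↑u = 1 := Units.inv_mul u
    rw [End.mul_def, hu] at this
    simpa using this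
  let e : End w := b ≫ ui ≫ a
  have hid : e * e = e := by
    simp only [e, End.mul_def, Category.assoc]
    rw [reassoc_of% h1]
  rcases IsLocalRing.isUnit_or_isUnit_of_add_one (a := e) (b := 1 - e) (by abel) with h | h
  · have he : e = 1 := h.mul_left_cancel (by rw [hid, mul_one])
    exact ⟨⟨b ≫ ui, a, by rw [Category.assoc]; exact he, by rw [h1]⟩⟩
  · have he : e = 0 := h.mul_left_cancel (by rw [sub_mul, hid, one_mul, sub_self, mul_zero])
    exfalso
    have h2 : (1 : End x) = 0 := by
      calc (1 : End x) = (a ≫ b ≫ ui) ≫ (a ≫ b ≫ ui) := by rw [h1]; simp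
        _ = a ≫ e ≫ b ≫ ui := by simp [e]
        _ = 0 := by rw [he]; change a ≫ (0 : w ⟶ w) ≫ b ≫ ui = 0; simp
    exact one_ne_zero h2

theorem exists_theta (k : Type*) [Field k] [PerfectField k]
    (C : Type*) [Category C] [Preadditive C] [Linear k C]
    (hfd : ∀ x : C, FiniteDimensional k (x ⟶ x)) (x : C) (hx : IsLocalRing (End x)) :
    ∃ θ : ∀ w : C, (w ⟶ w) →ₗ[k] k,
      (∀ (w w' : C) (f : w ⟶ w') (g : w' ⟶ w), IsLocalRing (End w) → IsLocalRing (End w') →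
        θ w (f ≫ g) = θ w' (g ≫ f)) ∧
      ∀ w, θ w (𝟙 w) = if Nonempty (w ≅ x) then 1 else 0 := by
  have : FiniteDimensional k (End x) := hfd x
  obtain ⟨φ, hφ1, hφc, hφ0⟩ := exists_local_functional k (End x)
  let φ' : (x ⟶ x) →ₗ[k] k := φ
  have hφ'1 : φ' (𝟙 x) = 1 := hφ1
  have hφ'c : ∀ a b : x ⟶ x, φ' (a ≫ b) = φ' (b ≫ a) := fun a b => hφc b a
  have hφ'0 : ∀ a : x ⟶ x, ¬ IsUnit (M := End x) a → φ' a = 0 := hφ0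
  let θ : ∀ w : C, (w ⟶ w) →ₗ[k] k := fun w =>
    if h : Nonempty (w ≅ x) then
      φ'.comp ((Linear.leftComp k x h.some.inv).comp (Linear.rightComp k w h.some.hom))
    else 0
  have hθ1 : ∀ w (h : Nonempty (w ≅ x)) (f : w ⟶ w),
      θ w f = φ' (h.some.inv ≫ f ≫ h.some.hom) := by
    intro w h f
    simp [θ, h]
  have hθ0 : ∀ w (h : ¬ Nonempty (w ≅ x)) (f : w ⟶ w), θ w f = 0 := by
    intro w h f
    simp only [θ, dif_neg h, LinearMap.zero_apply]
  have key : ∀ (w w' : C) (f : w ⟶ w') (g : w' ⟶ w), IsLocalRing (End w') →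
      Nonempty (w ≅ x) → ¬ Nonempty (w' ≅ x) → θ w (f ≫ g) = 0 := by
    intro w w' f g hw' h h'
    rw [hθ1 w h]
    apply hφ'0
    intro hu
    apply h'
    refine retract_iso x w' (h.some.inv ≫ f) (g ≫ h.some.hom) ?_
    simpa using hu
  refine ⟨θ, ?_, ?_⟩
  · intro w w' f g hw hw'
    by_cases h : Nonempty (w ≅ x) <;> by_cases h' : Nonempty (w' ≅ x)
    · rw [hθ1 w h, hθ1 w' h']
      have := hφ'c (h.some.inv ≫ f ≫ h'.some.hom) (h'.some.inv ≫ g ≫ h.some.hom)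
      simpa using this
    · rw [key w w' f g hw' h h', hθ0 w' h']
    · rw [key w' w g f hw h' h, hθ0 w h]
    · rw [hθ0 w h, hθ0 w' h']
  · intro w
    split_ifs with h
    · rw [hθ1 w h]; simpa using hφ'1
    · exact hθ0 w h _

theorem exists_trace (k : Type*) [Field k] [PerfectField k]
    (C : Type*) [Category C] [Preadditive C] [Linear k C] [HasFiniteBiproducts C]
    (hKS : ∀ x : C, ∃ (n : ℕ) (f : Fin n → C),
      (∀ i, IsLocalRing (End (f i))) ∧ Nonempty (x ≅ ⨁ f))
    (hfd : ∀ x : C, FiniteDimensional k (x ⟶ x)) (x : C) (hx : IsLocalRing (End x)) :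
    ∃ t : HH0 k C →ₗ[k] k, ∀ w, IsLocalRing (End w) →
      t (HH0.cls k (𝟙 w)) = if Nonempty (w ≅ x) then 1 else 0 := by
  obtain ⟨θ, hθ, hθ1⟩ := exists_theta k C hfd x hx
  choose n f hf e using hKS
  let ι : ∀ y (i : Fin (n y)), f y i ⟶ y := fun y i => biproduct.ι (f y) i ≫ (e y).some.inv
  let π : ∀ y (i : Fin (n y)), y ⟶ f y i := fun y i => (e y).some.hom ≫ biproduct.π (f y) i
  have hsum : ∀ y, ∑ i, π y i ≫ ι y i = 𝟙 y := by
    intro y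
    simp only [π, ι, Category.assoc]
    have h1 : ∀ i, biproduct.π (f y) i ≫ biproduct.ι (f y) i ≫ (e y).some.inv
        = (biproduct.π (f y) i ≫ biproduct.ι (f y) i) ≫ (e y).some.inv := by
      intro i; rw [Category.assoc]
    simp only [h1]
    rw [← Preadditive.comp_sum, ← Preadditive.sum_comp, biproduct.total]
    simp
  let t : ∀ y : C, (y ⟶ y) →ₗ[k] k := fun y =>
    ∑ i, (θ (f y i)).comp ((Linear.leftComp k _ (ι y i)).comp (Linear.rightComp k _ (π y i)))
  have ht : ∀ y (g : y ⟶ y), t y g = ∑ i, θ (f y i) (ι y i ≫ g ≫ π y i) := by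
    intro y g
    simp [t]
  have htr : ∀ (y z : C) (a : y ⟶ z) (b : z ⟶ y), t y (a ≫ b) = t z (b ≫ a) := by
    have hexp : ∀ (y z : C) (a : y ⟶ z) (b : z ⟶ y), t y (a ≫ b)
        = ∑ i, ∑ j, θ (f y i) ((ι y i ≫ a ≫ π z j) ≫ (ι z j ≫ b ≫ π y i)) := by
      intro y z a b
      rw [ht]
      refine Finset.sum_congr rfl fun i _ => ?_
      rw [← map_sum]
      congr 1
      have : a ≫ b = ∑ j, a ≫ (π z j ≫ ι z j) ≫ b := by
        rw [← Preadditive.comp_sum, ← Preadditive.sum_comp, hsum, Category.id_comp]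
      rw [this, Preadditive.sum_comp, Preadditive.comp_sum]
      simp
    intro y z a b
    rw [hexp, hexp, Finset.sum_comm]
    refine Finset.sum_congr rfl fun j _ => Finset.sum_congr rfl fun i _ => ?_
    exact hθ _ _ _ _ (hf y i) (hf z j)
  have hloc : ∀ w, IsLocalRing (End w) → t w (𝟙 w) = θ w (𝟙 w) := by
    intro w hw
    rw [ht, ← hsum w, map_sum]
    refine Finset.sum_congr rfl fun i _ => ?_
    rw [hsum, Category.id_comp]
    exact hθ _ _ _ _ (hf w i) hw
  let T : (⨁ y : C, (y ⟶ y)) →ₗ[k] k := DirectSum.toModule k C k t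
  have hT : ∀ y (g : y ⟶ y), T (DirectSum.of (fun z : C => z ⟶ z) y g) = t y g := by
    intro y g
    exact DirectSum.toModule_lof (R := k) (M := fun z : C => (z ⟶ z)) (φ := t) y g
  refine ⟨Submodule.liftQ _ T ?_, ?_⟩
  · rw [Submodule.span_le]
    rintro _ ⟨y, z, a, b, rfl⟩
    change T _ = 0
    rw [map_sub, hT, hT, htr, sub_self]
  · intro w hw
    rw [HH0.cls, ← Submodule.mkQ_apply, ← LinearMap.comp_apply, Submodule.liftQ_mkQ, hT, hloc w hw, hθ1]

section K0Lemmas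
variable {C : Type*} [Category C] [Preadditive C] [HasBinaryBiproducts C]

theorem K0_cls_iso {x y : C} (e : x ≅ y) : K0.cls x = K0.cls y := by
  unfold K0.cls
  rw [Quotient.sound (s := isIsomorphicSetoid C) (show (isIsomorphicSetoid C).r x y from ⟨e⟩)]

theorem K0_cls_biprod (x y : C) : K0.cls (x ⊞ y) = K0.cls x + K0.cls y := by
  rw [← sub_eq_zero, ← sub_sub]
  exact (QuotientAddGroup.eq_zero_iff (N := biprodRelations C) _).2
    (AddSubgroup.subset_closure ⟨x, y, rfl⟩)

theorem K0_cls_zero {x : C} (hx : IsZero x) : K0.cls x = 0 := by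
  have h1 : x ⊞ x ≅ x :=
    { hom := 0
      inv := 0
      hom_inv_id := by
        ext <;> exact hx.eq_of_src _ _
      inv_hom_id := hx.eq_of_src _ _ }
  have h2 := K0_cls_biprod x x
  rw [K0_cls_iso h1] at h2
  simpa using h2

theorem K0_cls_biproduct [HasFiniteBiproducts C] (n : ℕ) (f : Fin n → C) :
    K0.cls (⨁ f) = ∑ i, K0.cls (f i) := by
  induction n with
  | zero =>
    simp only [Finset.univ_eq_empty, Finset.sum_empty]
    apply K0_cls_zero
    rw [IsZero.iff_id_eq_zero]
    apply biproduct.hom_ext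
    intro i; exact i.elim0
  | succ n ih =>
    rw [Fin.sum_univ_succ, ← ih (fun i => f i.succ), ← K0_cls_biprod]
    apply K0_cls_iso
    refine
      { hom := biprod.lift (biproduct.π f 0) (biproduct.lift fun i => biproduct.π f i.succ)
        inv := biprod.desc (biproduct.ι f 0) (biproduct.desc fun i => biproduct.ι f i.succ)
        hom_inv_id := ?_
        inv_hom_id := ?_ }
    · rw [biprod.lift_desc, biproduct.lift_desc, ← biproduct.total, Fin.sum_univ_succ]
    · ext i j
      · simp
      · simp [biproduct.ι_π_ne _ (Fin.succ_ne_zero _).symm]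
      · simp [biproduct.ι_π_ne _ (Fin.succ_ne_zero _)]
      · simp [biproduct.ι_π]
end K0Lemmas

theorem chern_character_injective
    (k : Type*) [Field k] [PerfectField k]
    (C : Type*) [Category C] [Preadditive C] [Linear k C]
    [HasFiniteBiproducts C] [HasBinaryBiproducts C]
    -- Krull–Schmidt: every object is a finite direct sum of indecomposables with local
    -- endomorphism rings
    (hKS : ∀ x : C, ∃ (n : ℕ) (f : Fin n → C),
      (∀ i, IndecomposableObj (f i) ∧ IsLocalRing (End (f i))) ∧ Nonempty (x ≅ ⨁ f))
    -- every endomorphism algebra is finite-dimensional over `k`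
    (hfd : ∀ x : C, FiniteDimensional k (x ⟶ x))
    -- `h` is the Chern character, i.e. the `k`-linear map with `[x] ⊗ 1 ↦ [id_x]`
    (h : k ⊗[ℤ] K0 C →ₗ[k] HH0 k C)
    (hh : ∀ x : C, h ((1 : k) ⊗ₜ[ℤ] K0.cls x) = HH0.cls k (𝟙 x)) :
    Function.Injective h := by
  have hKS' : ∀ x : C, ∃ (n : ℕ) (f : Fin n → C),
      (∀ i, IsLocalRing (End (f i))) ∧ Nonempty (x ≅ ⨁ f) := by
    intro x
    obtain ⟨n, f, hf, e⟩ := hKS x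
    exact ⟨n, f, fun i => (hf i).2, e⟩
  -- representatives of isomorphism classes
  let rep : C → C := fun x => (Quotient.mk (isIsomorphicSetoid C) x).out
  have hrep : ∀ x, Nonempty (rep x ≅ x) := fun x =>
    Quotient.exact (s := isIsomorphicSetoid C) (Quotient.out_eq _)
  have hrep' : ∀ x y : C, Nonempty (x ≅ y) → rep x = rep y := by
    intro x y hxy
    have : Quotient.mk (isIsomorphicSetoid C) x = Quotient.mk (isIsomorphicSetoid C) y :=
      Quotient.sound (s := isIsomorphicSetoid C) hxy
    simp only [rep, this]
  have hiso : ∀ {x y : C}, (x ≅ y) → IsLocalRing (End x) → IsLocalRing (End y) := by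
    intro x y e hx
    have hn : Nontrivial (End y) := e.conj.injective.nontrivial
    refine { isUnit_or_isUnit_of_add_one := fun {a b} hab => ?_ }
    have hadd : e.conj.symm a + e.conj.symm b = e.conj.symm (a + b) := by
      change e.symm.conj a + e.symm.conj b = e.symm.conj (a + b)
      simp only [Iso.conj_apply]
      rw [Preadditive.add_comp, Preadditive.comp_add]
    rw [hab, map_one] at hadd
    rcases IsLocalRing.isUnit_or_isUnit_of_add_one hadd with h | h
    · exact Or.inl ((MulEquiv.isUnit_map e.conj.symm).1 h)
    · exact Or.inr ((MulEquiv.isUnit_map e.conj.symm).1 h)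
  let I := {w : C // IsLocalRing (End w) ∧ rep w = w}
  choose T hT using fun i : I => exists_trace k C hKS' hfd i.1 i.2.1
  let S : (I →₀ k) →ₗ[k] k ⊗[ℤ] K0 C :=
    Finsupp.lsum k (fun i => LinearMap.toSpanSingleton k _ ((1 : k) ⊗ₜ[ℤ] K0.cls i.1))
  have hS : ∀ i c, S (Finsupp.single i c) = c • ((1 : k) ⊗ₜ[ℤ] K0.cls i.1) := by
    intro i c
    simp [S]
  have hgen : ∀ x : C, (1 : k) ⊗ₜ[ℤ] K0.cls x ∈ LinearMap.range S := by
    intro x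
    obtain ⟨n, f, hf, ⟨e⟩⟩ := hKS' x
    rw [K0_cls_iso e, K0_cls_biproduct, TensorProduct.tmul_sum]
    refine Submodule.sum_mem _ fun i _ => ?_
    obtain ⟨e'⟩ := hrep (f i)
    refine ⟨Finsupp.single ⟨rep (f i), hiso e'.symm (hf i), hrep' _ _ ⟨e'⟩⟩ 1, ?_⟩
    rw [hS, one_smul, K0_cls_iso e']
  have hsurj : ∀ v, v ∈ LinearMap.range S := by
    intro v
    induction v using TensorProduct.induction_on with
    | zero => exact zero_mem _
    | add a b ha hb => exact add_mem ha hb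
    | tmul c a =>
      have h1 : c ⊗ₜ[ℤ] a = c • ((1 : k) ⊗ₜ[ℤ] a) := by
        rw [TensorProduct.smul_tmul', smul_eq_mul, mul_one]
      rw [h1]
      apply Submodule.smul_mem
      obtain ⟨b, rfl⟩ := QuotientAddGroup.mk_surjective a
      induction b using FreeAbelianGroup.induction_on with
      | zero => rw [QuotientAddGroup.mk_zero, TensorProduct.tmul_zero]; exact zero_mem _
      | of q =>
        induction q using Quotient.inductionOn with
        | h x => exact hgen x
      | neg q ih =>
        rw [QuotientAddGroup.mk_neg, TensorProduct.tmul_neg]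
        exact neg_mem (ih (by simp [TensorProduct.smul_tmul']))
      | add a b ha hb =>
        rw [QuotientAddGroup.mk_add, TensorProduct.tmul_add]
        exact add_mem (ha (by simp [TensorProduct.smul_tmul']))
          (hb (by simp [TensorProduct.smul_tmul']))
  have hcoef : ∀ (u : I →₀ k) (i : I), T i (h (S u)) = u i := by
    intro u i
    induction u using Finsupp.induction_linear with
    | zero => simp
    | add a b ha hb => simp [ha, hb]
    | single j c =>
      rw [hS, map_smul, map_smul, hh, hT i j.1 j.2.1, Finsupp.single_apply]
      by_cases hij : j = i
      · subst hij
        rw [if_pos ⟨Iso.refl _⟩]; simp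
      · rw [if_neg, if_neg hij, smul_zero]
        intro hji
        apply hij
        apply Subtype.ext
        rw [← j.2.2, ← i.2.2]
        exact hrep' _ _ hji
  rw [injective_iff_map_eq_zero]
  intro v hv
  obtain ⟨u, rfl⟩ := hsurj v
  have hu : u = 0 := by
    ext i
    rw [← hcoef u i, hv]; simp
  rw [hu, map_zero]
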